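/- Let χ: L → M be a morphism of cochain complexes of vector spaces over a field K of characteristic 0, and let Cone(χ) and H_χ[1] be the complexes defined in the context. Then the maps ι(l, m) = (l, t·χ(l) + dt·m), π(l, m(t,dt)) = (l, ∫₀¹ m(t,dt)), and K(l, m(t,dt)) = (0, t·∫₀¹ m(t,dt) − ∫₀^t m(s,ds)) satisfy: ι: Cone(χ) → H_χ[1] and π: H_χ[1] → Cone(χ) are morphisms of complexes, π∘ι = id on Cone(χ), and id − ι∘π = K∘q₁ + q₁∘K on H_χ[1], where q₁ denotes the differential of H_χ[1]. In particular Cone(χ) and H_χ[1] are homotopy equivalent complexes. -/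

import Mathlib

universe u

/-- A cochain complex of `K`-vector spaces, given by its components and its
degree-one differential.  (The condition `d ∘ d = 0` is `Cx.IsComplex`.) -/
structure Cx (K : Type u) [Field K] where
  V : ℤ → Type u
  [acg : ∀ i, AddCommGroup (V i)]
  [mod : ∀ i, Module K (V i)]
  d : ∀ i, V i →ₗ[K] V (i + 1)

attribute [instance] Cx.acg Cx.mod

/-- The differential squares to zero. -/
def Cx.IsComplex {K : Type u} [Field K] (A : Cx K) : Prop :=
  ∀ (i : ℤ) (x : A.V i), A.d (i + 1) (A.d i x) = 0

/-- A morphism of cochain complexes. -/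
structure CxHom {K : Type u} [Field K] (L M : Cx K) where
  f : ∀ i, L.V i →ₗ[K] M.V i
  comm : ∀ (i : ℤ) (x : L.V i), f (i + 1) (L.d i x) = M.d i (f i x)

section finsuppOps

variable (K : Type u) [Field K] (M : Type u) [AddCommGroup M] [Module K M]

/-- An element `p : ℕ →₀ M` represents the polynomial `p(t) = Σ_k t^k • (p k)`
with coefficients in `M`.  `coeffSum p = p(1)` is the sum of the coefficients. -/
noncomputable def coeffSum : (ℕ →₀ M) →ₗ[K] M :=
  Finsupp.lsum K fun _ => LinearMap.id

/-- Evaluation at `0`: `p(0)` is the constant coefficient. -/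
noncomputable def ev0 : (ℕ →₀ M) →ₗ[K] M := Finsupp.lapply 0

/-- The formal derivative `p'(t)`. -/
noncomputable def polyDeriv : (ℕ →₀ M) →ₗ[K] (ℕ →₀ M) :=
  Finsupp.lsum K fun k => (k : K) • Finsupp.lsingle (k - 1)

/-- The formal integral `∫₀¹ p(t) dt = Σ_k (p k)/(k+1)`. -/
noncomputable def intOne : (ℕ →₀ M) →ₗ[K] M :=
  Finsupp.lsum K fun k => ((k : K) + 1)⁻¹ • LinearMap.id

/-- The formal antiderivative `∫₀ᵗ p(s) ds`. -/
noncomputable def antider : (ℕ →₀ M) →ₗ[K] (ℕ →₀ M) :=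
  Finsupp.lsum K fun k => ((k : K) + 1)⁻¹ • Finsupp.lsingle (k + 1)

end finsuppOps

variable {K : Type u} [Field K]

lemma coeffSum_mapRange {M N : Type u} [AddCommGroup M] [Module K M]
    [AddCommGroup N] [Module K N] (f : M →ₗ[K] N) (p : ℕ →₀ M) :
    coeffSum K N (Finsupp.mapRange.linearMap f p) = f (coeffSum K M p) := by
  induction p using Finsupp.induction_linear with
  | zero => simp
  | add p q hp hq => simp only [map_add, hp, hq]
  | single k m => simp [coeffSum]

lemma ev0_mapRange {M N : Type u} [AddCommGroup M] [Module K M]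
    [AddCommGroup N] [Module K N] (f : M →ₗ[K] N) (p : ℕ →₀ M) :
    ev0 K N (Finsupp.mapRange.linearMap f p) = f (ev0 K M p) := by
  simp [ev0]


lemma ev0_antider {M : Type u} [AddCommGroup M] [Module K M] (q : ℕ →₀ M) :
    ev0 K M (antider K M q) = 0 := by
  induction q using Finsupp.induction_linear with
  | zero => simp
  | add p q hp hq => rw [map_add, map_add, hp, hq, add_zero]
  | single k m => simp [antider, ev0, Finsupp.single_apply]

lemma coeffSum_antider {M : Type u} [AddCommGroup M] [Module K M] (q : ℕ →₀ M) :
    coeffSum K M (antider K M q) = intOne K M q := by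
  induction q using Finsupp.induction_linear with
  | zero => simp
  | add p q hp hq => rw [map_add, map_add, hp, hq, map_add]
  | single k m => simp [antider, coeffSum, intOne]

section cone

variable (L M : Cx K) (χ : CxHom L M)

/-- The suspended mapping cone `Cone(χ)`: its degree-`i` component is
`L^{i+1} ⊕ M^i`, with differential `q₁(l, m) = (−dl, −χ(l) + dm)`. -/
def coneCx : Cx K where
  V i := L.V (i + 1) × M.V i
  d i := LinearMap.prod
    ((- L.d (i + 1)) ∘ₗ LinearMap.fst K (L.V (i + 1)) (M.V i))
    ((M.d i) ∘ₗ LinearMap.snd K (L.V (i + 1)) (M.V i) -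
      (χ.f (i + 1)) ∘ₗ LinearMap.fst K (L.V (i + 1)) (M.V i))

/-- The ambient space of the degree-`i` component of `H_χ[1]`: an element
`(l, p, q)` represents `(l, p(t) + dt·q(t))` with `l ∈ L^{i+1}`,
`p ∈ M^{i+1}[t]`, `q ∈ M^i[t]`. -/
abbrev bigV (i : ℤ) : Type u := L.V (i + 1) × (ℕ →₀ M.V (i + 1)) × (ℕ →₀ M.V i)

/-- Projection onto `l`. -/
noncomputable def lPr (i : ℤ) : bigV L M i →ₗ[K] L.V (i + 1) := LinearMap.fst K _ _

/-- Projection onto `p`. -/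
noncomputable def pPr (i : ℤ) : bigV L M i →ₗ[K] (ℕ →₀ M.V (i + 1)) :=
  (LinearMap.fst K _ _) ∘ₗ (LinearMap.snd K (L.V (i + 1)) _)

/-- Projection onto `q`. -/
noncomputable def qPr (i : ℤ) : bigV L M i →ₗ[K] (ℕ →₀ M.V i) :=
  (LinearMap.snd K _ _) ∘ₗ (LinearMap.snd K (L.V (i + 1)) _)

/-- The degree-`i` component of `H_χ[1]`: the conditions `m(0,0) = 0` and
`m(1,0) = χ(l)`, i.e. `p(0) = 0` and `p(1) = χ(l)`. -/
noncomputable def Hsub (i : ℤ) : Submodule K (bigV L M i) :=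
  LinearMap.ker ((ev0 K (M.V (i + 1))) ∘ₗ pPr L M i) ⊓
    LinearMap.ker ((coeffSum K (M.V (i + 1))) ∘ₗ pPr L M i - (χ.f (i + 1)) ∘ₗ lPr L M i)

/-- The (suspended) differential of `H_χ[1]` on the ambient space:
`q₁(l, p + dt·q) = (−dl, −d_M p + dt·(d_M q − p'))`. -/
noncomputable def Damb (i : ℤ) : bigV L M i →ₗ[K] bigV L M (i + 1) :=
  LinearMap.prod ((- L.d (i + 1)) ∘ₗ lPr L M i)
    (LinearMap.prod
      ((- Finsupp.mapRange.linearMap (M.d (i + 1))) ∘ₗ pPr L M i)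
      ((Finsupp.mapRange.linearMap (M.d i)) ∘ₗ qPr L M i -
        (polyDeriv K (M.V (i + 1))) ∘ₗ pPr L M i))

lemma Damb_mem (i : ℤ) : ∀ x ∈ Hsub L M χ i, Damb L M i x ∈ Hsub L M χ (i + 1) := by
  intro x hx
  rcases Submodule.mem_inf.mp hx with ⟨h0, h1⟩
  simp only [LinearMap.mem_ker, LinearMap.comp_apply, LinearMap.sub_apply,
    sub_eq_zero] at h0 h1
  refine Submodule.mem_inf.mpr ⟨?_, ?_⟩
  · simp only [LinearMap.mem_ker, LinearMap.comp_apply]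
    show ev0 K (M.V (i + 1 + 1))
      ((- Finsupp.mapRange.linearMap (M.d (i + 1))) (pPr L M i x)) = 0
    rw [LinearMap.neg_apply, map_neg, ev0_mapRange, h0, map_zero, neg_zero]
  · simp only [LinearMap.mem_ker, LinearMap.comp_apply, LinearMap.sub_apply,
      sub_eq_zero]
    show coeffSum K (M.V (i + 1 + 1))
        ((- Finsupp.mapRange.linearMap (M.d (i + 1))) (pPr L M i x)) =
      χ.f (i + 1 + 1) ((- L.d (i + 1)) (lPr L M i x))
    rw [LinearMap.neg_apply, map_neg, coeffSum_mapRange, h1, LinearMap.neg_apply,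
      map_neg, χ.comm]

/-- The complex `H_χ[1]`. -/
noncomputable def Hcx : Cx K where
  V i := ↥(Hsub L M χ i)
  d i := (Damb L M i).restrict (Damb_mem L M χ i)

lemma iota_mem (i : ℤ) (x : (coneCx L M χ).V i) :
    (LinearMap.prod (LinearMap.fst K (L.V (i + 1)) (M.V i))
      (LinearMap.prod
        ((Finsupp.lsingle 1) ∘ₗ (χ.f (i + 1)) ∘ₗ LinearMap.fst K (L.V (i + 1)) (M.V i))
        ((Finsupp.lsingle 0) ∘ₗ LinearMap.snd K (L.V (i + 1)) (M.V i)))) x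
      ∈ Hsub L M χ i := by
  refine Submodule.mem_inf.mpr ⟨?_, ?_⟩
  · show ev0 K (M.V (i + 1)) (Finsupp.single (1 : ℕ) (χ.f (i + 1) x.1)) = 0
    simp [ev0, Finsupp.single_apply]
  · show coeffSum K (M.V (i + 1)) (Finsupp.single (1 : ℕ) (χ.f (i + 1) x.1)) -
      χ.f (i + 1) x.1 = 0
    simp [coeffSum]

/-- The map `ι(l, m) = (l, t·χ(l) + dt·m)`. -/
noncomputable def iotaMap (i : ℤ) : (coneCx L M χ).V i →ₗ[K] (Hcx L M χ).V i :=
  LinearMap.codRestrict (Hsub L M χ i) _ (iota_mem L M χ i)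

/-- The map `π(l, p + dt·q) = (l, ∫₀¹ q(t) dt)`. -/
noncomputable def piMap (i : ℤ) : (Hcx L M χ).V i →ₗ[K] (coneCx L M χ).V i :=
  (LinearMap.prod (lPr L M i) ((intOne K (M.V i)) ∘ₗ qPr L M i)) ∘ₗ
    (Hsub L M χ i).subtype

lemma Kop_mem (i : ℤ) (q : ℕ →₀ M.V (i + 1)) :
    ((0 : L.V (i + 1)),
      Finsupp.single (1 : ℕ) (intOne K (M.V (i + 1)) q) - antider K (M.V (i + 1)) q,
      (0 : ℕ →₀ M.V i)) ∈ Hsub L M χ i := by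
  refine Submodule.mem_inf.mpr ⟨?_, ?_⟩
  · show ev0 K (M.V (i + 1))
      (Finsupp.single (1 : ℕ) (intOne K (M.V (i + 1)) q) -
        antider K (M.V (i + 1)) q) = 0
    rw [map_sub, ev0_antider, sub_zero]
    simp [ev0, Finsupp.single_apply]
  · show coeffSum K (M.V (i + 1))
      (Finsupp.single (1 : ℕ) (intOne K (M.V (i + 1)) q) -
        antider K (M.V (i + 1)) q) - χ.f (i + 1) 0 = 0
    rw [map_zero, sub_zero, map_sub, coeffSum_antider]
    have h1 : coeffSum K (M.V (i + 1)) (Finsupp.single (1 : ℕ)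
        (intOne K (M.V (i + 1)) q)) = intOne K (M.V (i + 1)) q := by
      simp [coeffSum]
    rw [h1, sub_self]

/-- The homotopy `K(l, p + dt·q) = (0, t·∫₀¹ q(t) dt − ∫₀ᵗ q(s) ds, 0)`,
of degree `−1`. -/
noncomputable def KMap (i : ℤ) : (Hcx L M χ).V (i + 1) →ₗ[K] (Hcx L M χ).V i :=
  LinearMap.codRestrict (Hsub L M χ i)
    ((LinearMap.prod (0 : bigV L M (i + 1) →ₗ[K] L.V (i + 1))
      (LinearMap.prod
        ((Finsupp.lsingle 1) ∘ₗ (intOne K (M.V (i + 1))) ∘ₗ qPr L M (i + 1) -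
          (antider K (M.V (i + 1))) ∘ₗ qPr L M (i + 1))
        (0 : bigV L M (i + 1) →ₗ[K] (ℕ →₀ M.V i)))) ∘ₗ (Hsub L M χ (i + 1)).subtype)
    (fun x => by
      exact Kop_mem L M χ i (qPr L M (i + 1) x.1))

end cone

lemma intOne_mapRange {M N : Type u} [AddCommGroup M] [Module K M]
    [AddCommGroup N] [Module K N] (f : M →ₗ[K] N) (p : ℕ →₀ M) :
    intOne K N (Finsupp.mapRange.linearMap f p) = f (intOne K M p) := by
  induction p using Finsupp.induction_linear with
  | zero => simp
  | add p q hp hq => simp only [map_add, hp, hq]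
  | single k m => simp [intOne]

lemma antider_mapRange {M N : Type u} [AddCommGroup M] [Module K M]
    [AddCommGroup N] [Module K N] (f : M →ₗ[K] N) (p : ℕ →₀ M) :
    antider K N (Finsupp.mapRange.linearMap f p) =
      Finsupp.mapRange.linearMap f (antider K M p) := by
  induction p using Finsupp.induction_linear with
  | zero => simp
  | add p q hp hq => simp only [map_add, hp, hq]
  | single k m => simp [antider]

lemma polyDeriv_antider [CharZero K] {M : Type u} [AddCommGroup M] [Module K M] (p : ℕ →₀ M) :
    polyDeriv K M (antider K M p) = p := by
  induction p using Finsupp.induction_linear with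
  | zero => simp
  | add p q hp hq => simp only [map_add, hp, hq]
  | single k m =>
    have h : (k : K) + 1 ≠ 0 := by exact_mod_cast Nat.succ_ne_zero k
    simp [antider, polyDeriv, smul_smul, h]

lemma polyDeriv_single_one {M : Type u} [AddCommGroup M] [Module K M] (m : M) :
    polyDeriv K M (Finsupp.single 1 m) = Finsupp.single 0 m := by
  simp [polyDeriv]

lemma intOne_single_zero {M : Type u} [AddCommGroup M] [Module K M] (m : M) :
    intOne K M (Finsupp.single 0 m) = m := by
  simp [intOne]

lemma antider_polyDeriv [CharZero K] {M : Type u} [AddCommGroup M] [Module K M] (p : ℕ →₀ M) :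
    antider K M (polyDeriv K M p) = p - Finsupp.single 0 (ev0 K M p) := by
  induction p using Finsupp.induction_linear with
  | zero => simp
  | add p q hp hq => simp only [map_add, hp, hq, Finsupp.single_add]; abel
  | single k m =>
    cases k with
    | zero => simp [polyDeriv, ev0]
    | succ k =>
      have h : (k : K) + 1 ≠ 0 := by exact_mod_cast Nat.succ_ne_zero k
      simp [antider, polyDeriv, ev0, smul_smul, h]

lemma intOne_polyDeriv [CharZero K] {M : Type u} [AddCommGroup M] [Module K M] (p : ℕ →₀ M) :
    intOne K M (polyDeriv K M p) = coeffSum K M p - ev0 K M p := by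
  rw [← coeffSum_antider, antider_polyDeriv, map_sub]
  simp [coeffSum]

/-- Let `χ : L → M` be a morphism of cochain complexes over a field `K` of
characteristic zero.  Then for the suspended mapping cone `Cone(χ)` (with
components `L^{i+1} ⊕ M^i` and differential `(l, m) ↦ (−dl, −χ(l) + dm)`) and
the complex `H_χ[1]` (whose degree-`i` component consists of the pairs
`(l, m(t,dt))` with `l ∈ L^{i+1}`, `m(t,dt) = p(t) + dt·q(t)`, `p ∈ M^{i+1}[t]`,
`q ∈ M^i[t]`, `m(0,0) = 0` and `m(1,0) = χ(l)`), the maps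
`ι(l, m) = (l, t·χ(l) + dt·m)`, `π(l, m(t,dt)) = (l, ∫₀¹ m(t,dt))` and
`K(l, m(t,dt)) = (0, t·∫₀¹ m(t,dt) − ∫₀ᵗ m(s,ds))` satisfy:  `ι` and `π` are
morphisms of complexes, `π ∘ ι = id`, and `id − ι∘π = K∘q₁ + q₁∘K`, where `q₁`
is the differential of `H_χ[1]`.  In particular `Cone(χ)` and `H_χ[1]` are
homotopy equivalent complexes. -/
theorem cone_homotopy_equiv [CharZero K] (L M : Cx K)
    (hL : L.IsComplex) (hM : M.IsComplex) (χ : CxHom L M) :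
    (∀ (i : ℤ) (x : (coneCx L M χ).V i),
      iotaMap L M χ (i + 1) ((coneCx L M χ).d i x) =
        (Hcx L M χ).d i (iotaMap L M χ i x)) ∧
    (∀ (i : ℤ) (x : (Hcx L M χ).V i),
      piMap L M χ (i + 1) ((Hcx L M χ).d i x) =
        (coneCx L M χ).d i (piMap L M χ i x)) ∧
    (∀ (i : ℤ) (x : (coneCx L M χ).V i), piMap L M χ i (iotaMap L M χ i x) = x) ∧
    (∀ (i : ℤ) (x : (Hcx L M χ).V (i + 1)),
      x - iotaMap L M χ (i + 1) (piMap L M χ (i + 1) x) =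
        KMap L M χ (i + 1) ((Hcx L M χ).d (i + 1) x) +
          (Hcx L M χ).d i (KMap L M χ i x)) := by
  refine ⟨?_, ?_, ?_, ?_⟩
  · rintro i ⟨l, m⟩
    apply Subtype.ext
    change ((-L.d (i + 1) l, Finsupp.single 1 (χ.f (i + 1 + 1) (-L.d (i + 1) l)),
        Finsupp.single 0 (M.d i m - χ.f (i + 1) l)) : bigV L M (i + 1)) =
      (-L.d (i + 1) l,
        -Finsupp.mapRange.linearMap (M.d (i + 1)) (Finsupp.single 1 (χ.f (i + 1) l)),
        Finsupp.mapRange.linearMap (M.d i) (Finsupp.single 0 m) -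
          polyDeriv K (M.V (i + 1)) (Finsupp.single 1 (χ.f (i + 1) l)))
    rw [polyDeriv_single_one, map_neg, χ.comm]
    simp [Finsupp.single_sub]
  · rintro i ⟨⟨l, p, q⟩, hx⟩
    rcases Submodule.mem_inf.mp hx with ⟨h0, h1⟩
    replace h0 : ev0 K (M.V (i + 1)) p = 0 := h0
    replace h1 : coeffSum K (M.V (i + 1)) p - χ.f (i + 1) l = 0 := h1
    change ((-L.d (i + 1) l, intOne K (M.V (i + 1))
        (Finsupp.mapRange.linearMap (M.d i) q - polyDeriv K (M.V (i + 1)) p)) :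
          L.V (i + 1 + 1) × M.V (i + 1)) =
      (-L.d (i + 1) l, M.d i (intOne K (M.V i) q) - χ.f (i + 1) l)
    rw [map_sub, intOne_mapRange, intOne_polyDeriv, h0, sub_eq_zero.mp h1, sub_zero]
  · rintro i ⟨l, m⟩
    change ((l, intOne K (M.V i) (Finsupp.single 0 m)) : L.V (i + 1) × M.V i) = (l, m)
    rw [intOne_single_zero]
  · rintro i ⟨⟨l, p, q⟩, hx⟩
    rcases Submodule.mem_inf.mp hx with ⟨h0, h1⟩
    replace h0 : ev0 K (M.V (i + 1 + 1)) p = 0 := h0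
    replace h1 : coeffSum K (M.V (i + 1 + 1)) p - χ.f (i + 1 + 1) l = 0 := h1
    apply Subtype.ext
    change ((l - l, p - Finsupp.single 1 (χ.f (i + 1 + 1) l),
        q - Finsupp.single 0 (intOne K (M.V (i + 1)) q)) : bigV L M (i + 1)) =
      (0 + -L.d (i + 1) 0,
        (Finsupp.single 1 (intOne K (M.V (i + 1 + 1))
          (Finsupp.mapRange.linearMap (M.d (i + 1)) q - polyDeriv K (M.V (i + 1 + 1)) p)) -
          antider K (M.V (i + 1 + 1))
          (Finsupp.mapRange.linearMap (M.d (i + 1)) q - polyDeriv K (M.V (i + 1 + 1)) p)) +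
        -Finsupp.mapRange.linearMap (M.d (i + 1))
          (Finsupp.single 1 (intOne K (M.V (i + 1)) q) - antider K (M.V (i + 1)) q),
        0 + (Finsupp.mapRange.linearMap (M.d i) 0 - polyDeriv K (M.V (i + 1))
          (Finsupp.single 1 (intOne K (M.V (i + 1)) q) - antider K (M.V (i + 1)) q)))
    have hs : Finsupp.mapRange.linearMap (M.d (i + 1))
        (Finsupp.single 1 (intOne K (M.V (i + 1)) q)) =
        Finsupp.single 1 (M.d (i + 1) (intOne K (M.V (i + 1)) q)) := by simp
    refine Prod.ext ?_ (Prod.ext ?_ ?_)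
    · simp
    · simp only [map_sub, intOne_mapRange, intOne_polyDeriv, antider_mapRange,
        antider_polyDeriv, h0, sub_eq_zero.mp h1, hs, Finsupp.single_sub, Finsupp.single_zero]
      abel
    · simp only [map_sub, map_zero, polyDeriv_single_one, polyDeriv_antider]
      abel
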